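/- Let p ∈ [0,1] and let K₀ = [[1,0],[0,√p]], K₁ = [[0,√(1−p)],[0,0]] be the Kraus operators of the qubit amplitude damping channel. Set ρ'' = Σᵢ₌₀¹ Σⱼ₌₀¹ (Kᵢ⊗Kⱼ)·ρ_AB·(Kᵢ⊗Kⱼ)†, the state with the amplitude damping channel applied to both qubits. Then tr[ρ''·𝔅] = 4(1 + 2p²)/√3. -/

import Mathlib

open Matrix Kronecker
open scoped ComplexOrder

noncomputable def σx : Matrix (Fin 2) (Fin 2) ℂ := !![0, 1; 1, 0]
noncomputable def σy : Matrix (Fin 2) (Fin 2) ℂ := !![0, -Complex.I; Complex.I, 0]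
noncomputable def σz : Matrix (Fin 2) (Fin 2) ℂ := !![1, 0; 0, -1]

/-- Bob's observables for the Elegant Bell inequality. -/
noncomputable def B1 : Matrix (Fin 2) (Fin 2) ℂ := (Real.sqrt 3 : ℂ)⁻¹ • (σx - σy + σz)
noncomputable def B2 : Matrix (Fin 2) (Fin 2) ℂ := (Real.sqrt 3 : ℂ)⁻¹ • (σx + σy - σz)
noncomputable def B3 : Matrix (Fin 2) (Fin 2) ℂ := (Real.sqrt 3 : ℂ)⁻¹ • (-σx - σy - σz)
noncomputable def B4 : Matrix (Fin 2) (Fin 2) ℂ := (Real.sqrt 3 : ℂ)⁻¹ • (-σx + σy + σz)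

/-- The EBI Bell operator 𝔅 with Alice's observables A₁ = σx, A₂ = σy, A₃ = σz. -/
noncomputable def EBIop : Matrix (Fin 2 × Fin 2) (Fin 2 × Fin 2) ℂ :=
  σx ⊗ₖ (B1 + B2 - B3 - B4) + σy ⊗ₖ (B1 - B2 + B3 - B4) + σz ⊗ₖ (B1 - B2 - B3 + B4)

/-- The maximally entangled two-qubit state. -/
noncomputable def ρAB : Matrix (Fin 2 × Fin 2) (Fin 2 × Fin 2) ℂ :=
  (4 : ℂ)⁻¹ • ((1 : Matrix (Fin 2) (Fin 2) ℂ) ⊗ₖ (1 : Matrix (Fin 2) (Fin 2) ℂ)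
    + σx ⊗ₖ σx - σy ⊗ₖ σy + σz ⊗ₖ σz)

/-- Kraus operators of the qubit amplitude damping channel with parameter `p`. -/
noncomputable def adK (p : ℝ) : Fin 2 → Matrix (Fin 2) (Fin 2) ℂ :=
  ![!![1, 0; 0, (Real.sqrt p : ℂ)],
    !![0, (Real.sqrt (1 - p) : ℂ); 0, 0]]

theorem EBIop_eq :
    EBIop = (4 * (Real.sqrt 3 : ℂ)⁻¹) • (σx ⊗ₖ σx - σy ⊗ₖ σy + σz ⊗ₖ σz) := by
  have hx : B1 + B2 - B3 - B4 = (4 * (Real.sqrt 3 : ℂ)⁻¹) • σx := by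
    unfold B1 B2 B3 B4; module
  have hy : B1 - B2 + B3 - B4 = (-(4 * (Real.sqrt 3 : ℂ)⁻¹)) • σy := by
    unfold B1 B2 B3 B4; module
  have hz : B1 - B2 - B3 + B4 = (4 * (Real.sqrt 3 : ℂ)⁻¹) • σz := by
    unfold B1 B2 B3 B4; module
  rw [EBIop, hx, hy, hz]
  simp only [kronecker_smul]
  module

/-- Applying the amplitude damping channel to both qubits of the maximally
entangled state gives EBI value `4(1 + 2p²)/√3`. -/
theorem AD_both_qubits_EBI_value (p : ℝ) (hp0 : 0 ≤ p) (hp1 : p ≤ 1) :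
    ((∑ i : Fin 2, ∑ j : Fin 2, (adK p i ⊗ₖ adK p j) * ρAB
        * (adK p i ⊗ₖ adK p j)ᴴ) * EBIop).trace
      = ((4 * (1 + 2 * p ^ 2) / Real.sqrt 3 : ℝ) : ℂ) := by
  have hp : (Real.sqrt p : ℂ) * Real.sqrt p = p := by
    exact_mod_cast Real.mul_self_sqrt hp0
  have hq : (Real.sqrt (1 - p) : ℂ) * Real.sqrt (1 - p) = 1 - p := by
    exact_mod_cast Real.mul_self_sqrt (sub_nonneg.mpr hp1)
  rw [EBIop_eq, mul_smul_comm, trace_smul, smul_eq_mul]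
  simp [adK, ρAB, σx, σy, σz, trace, Matrix.mul_apply, Fintype.sum_prod_type,
    Fin.sum_univ_two, kroneckerMap_apply, Matrix.one_apply]
  linear_combination (Real.sqrt 3 : ℂ)⁻¹ *
    ((-4 * ((Real.sqrt (1 - p) : ℂ) * Real.sqrt (1 - p)) + 8
        + 2 * ((Real.sqrt p : ℂ) * Real.sqrt p + p)) * hp
      + (-4 * p + 2 * ((Real.sqrt (1 - p) : ℂ) * Real.sqrt (1 - p) + 1 - p)) * hq)
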